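/- arXiv:1411.5801 — 8 statements merged into one kernel-verified Lean document; each statement's English description precedes it below -/
import Mathlib

section
/- Let A be a real 3×3 matrix with third row (0,0,1) and det A > 0 which is coherent, i.e. there exists a family 𝒜 : [-1,1] → M₃(ℝ) whose nine entry functions are real-analytic on [-1,1], with 𝒜(0) = A and, for every t ∈ [-1,1] with t ≠ 0, 𝒜(t)ᵀ Qₜ 𝒜(t) = Qₜ and det 𝒜(t) > 0. Then the upper-left 2×2 block of A is a rotation matrix, i.e. A₁₁² + A₂₁² = 1, A₁₂² + A₂₂² = 1, A₁₁A₁₂ + A₂₁A₂₂ = 0, and A₁₁A₂₂ − A₁₂A₂₁ = 1; hence A represents an orientation-preserving isometry of the Euclidean plane. -/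
open Matrix

/-- The diagonal matrix `Qₜ = diag(t, t, 1)` of the quadratic form
`qₜ(x,y,z) = t·x² + t·y² + z²`. -/
def Q (t : ℝ) : Matrix (Fin 3) (Fin 3) ℝ := Matrix.diagonal ![t, t, 1]

open Filter Topology

/-- If `t * f t + c t * d t = t * k` near `0` and `c`, `d` vanish at `0` and are regular enough,
then the product `c t * d t` is `o(t)`, so the limit of `f` at `0` is `k`. -/
lemma eq_of_eventually_mul_add_mul_eq {f c d : ℝ → ℝ} {k : ℝ}
    (hf : ContinuousAt f 0) (hc : DifferentiableAt ℝ c 0) (hd : ContinuousAt d 0)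
    (hc0 : c 0 = 0) (hd0 : d 0 = 0)
    (h : ∀ᶠ t in 𝓝[≠] (0 : ℝ), t * f t + c t * d t = t * k) : f 0 = k := by
  have hslope := hasDerivAt_iff_tendsto_slope.mp hc.hasDerivAt
  have hdlim : Tendsto d (𝓝[≠] 0) (𝓝 (d 0)) := hd.tendsto.mono_left nhdsWithin_le_nhds
  have hflim : Tendsto f (𝓝[≠] 0) (𝓝 (f 0)) := hf.tendsto.mono_left nhdsWithin_le_nhds
  have hlim := hflim.add (hslope.mul hdlim)
  rw [hd0, mul_zero, add_zero] at hlim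
  refine tendsto_nhds_unique hlim (tendsto_const_nhds.congr' ?_)
  filter_upwards [h, self_mem_nhdsWithin] with t ht htne
  have htne : t ≠ 0 := htne
  rw [slope_def_field, hc0]
  field_simp
  linarith

/-- If `A` is a coherent real 3×3 matrix with third row `(0,0,1)` and positive determinant,
then its upper-left 2×2 block is a rotation matrix (an element of `SO(2)`), so `A` is an
orientation-preserving motion of the Euclidean plane. -/
theorem coherent_is_euclidean_motion (A : Matrix (Fin 3) (Fin 3) ℝ)
    (hrow : A 2 = ![0, 0, 1])
    (hdetA : 0 < A.det)
    (Afam : ℝ → Matrix (Fin 3) (Fin 3) ℝ)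
    (hanalytic : ∀ i j : Fin 3, AnalyticOn ℝ (fun t => Afam t i j) (Set.Icc (-1 : ℝ) 1))
    (h0 : Afam 0 = A)
    (hpres : ∀ t ∈ Set.Icc (-1 : ℝ) 1, t ≠ 0 → (Afam t)ᵀ * Q t * Afam t = Q t)
    (hdet : ∀ t ∈ Set.Icc (-1 : ℝ) 1, t ≠ 0 → 0 < (Afam t).det) :
    A 0 0 ^ 2 + A 1 0 ^ 2 = 1 ∧
    A 0 1 ^ 2 + A 1 1 ^ 2 = 1 ∧
    A 0 0 * A 0 1 + A 1 0 * A 1 1 = 0 ∧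
    A 0 0 * A 1 1 - A 0 1 * A 1 0 = 1 := by
  have hnhds : Set.Icc (-1 : ℝ) 1 ∈ 𝓝 (0 : ℝ) := Icc_mem_nhds (by norm_num) (by norm_num)
  have hdiff (i j : Fin 3) : DifferentiableAt ℝ (fun t => Afam t i j) 0 :=
    (hanalytic i j).differentiableOn.differentiableAt hnhds
  have hcont (i j : Fin 3) : ContinuousAt (fun t => Afam t i j) 0 := (hdiff i j).continuousAt
  have h20 : A 2 0 = 0 := by simp [hrow]
  have h21 : A 2 1 = 0 := by simp [hrow]
  have h22 : A 2 2 = 1 := by simp [hrow]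
  have hgram (i j : Fin 3) (k : ℝ) (hi : A 2 i = 0) (hj : A 2 j = 0)
      (hk : ∀ t, Q t i j = t * k) : A 0 i * A 0 j + A 1 i * A 1 j = k := by
    have hlim := eq_of_eventually_mul_add_mul_eq (k := k)
      (((hcont 0 i).mul (hcont 0 j)).add ((hcont 1 i).mul (hcont 1 j)))
      (hdiff 2 i) (hcont 2 j) (by rw [h0, hi]) (by rw [h0, hj]) ?_
    · simpa [h0] using hlim
    filter_upwards [nhdsWithin_le_nhds hnhds, self_mem_nhdsWithin] with t ht htne
    have hentry := congrFun (congrFun (hpres t ht htne) i) j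
    rw [hk] at hentry
    rw [← hentry]
    simp [Q, Matrix.mul_apply, Fin.sum_univ_three, Matrix.diagonal_apply]
    ring
  have h00 := hgram 0 0 1 h20 h20 (by simp [Q])
  have h11 := hgram 1 1 1 h21 h21 (by simp [Q])
  have h01 := hgram 0 1 0 h20 h21 (by simp [Q])
  rw [Matrix.det_fin_three, h20, h21, h22] at hdetA
  refine ⟨by linarith, by linarith, h01, ?_⟩
  have hsq : (A 0 0 * A 1 1 - A 0 1 * A 1 0) ^ 2 = 1 := by
    linear_combination (A 0 1 * A 0 1 + A 1 1 * A 1 1) * h00 + h11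
      - (A 0 0 * A 0 1 + A 1 0 * A 1 1) * h01
  exact (pow_eq_one_iff_of_nonneg (by linarith) two_ne_zero).mp hsq
end

section
/- Let 𝒜 : [-1,1] → M₃(ℝ) be a family of matrices whose entry functions are real-analytic on [-1,1] (in particular differentiable at 0), such that for every t ≠ 0 in [-1,1] one has 𝒜(t)ᵀ Qₜ 𝒜(t) = Qₜ. Then the (3,1) entry satisfies 𝒜(0)₃₁ = 0, the limit of 𝒜(t)₃₁²/t as t → 0 is 0, and consequently 𝒜(0)₁₁² + 𝒜(0)₂₁² = 1. -/
open Matrix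

/-- For a family `𝒜 : [-1,1] → M₃(ℝ)` with real-analytic entries preserving `qₜ` for
every `t ≠ 0`, the `(3,1)` entry vanishes at `0`, `𝒜(t)₃₁²/t → 0` as `t → 0`, and
consequently `𝒜(0)₁₁² + 𝒜(0)₂₁² = 1`. -/
theorem coherent_entry_three_one (Afam : ℝ → Matrix (Fin 3) (Fin 3) ℝ)
    (hanalytic : ∀ i j : Fin 3, AnalyticOn ℝ (fun t => Afam t i j) (Set.Icc (-1 : ℝ) 1))
    (hpres : ∀ t ∈ Set.Icc (-1 : ℝ) 1, t ≠ 0 → (Afam t)ᵀ * Q t * Afam t = Q t) :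
    Afam 0 2 0 = 0 ∧
    Filter.Tendsto (fun t => (Afam t 2 0) ^ 2 / t)
      (nhdsWithin 0 (Set.Icc (-1 : ℝ) 1 \ {0})) (nhds 0) ∧
    (Afam 0 0 0) ^ 2 + (Afam 0 1 0) ^ 2 = 1 := by
  have hmem : Set.Icc (-1 : ℝ) 1 ∈ nhds (0 : ℝ) := Icc_mem_nhds (by norm_num) (by norm_num)
  have hfilter : nhdsWithin (0 : ℝ) (Set.Icc (-1 : ℝ) 1 \ {0}) = nhdsWithin 0 {0}ᶜ := by
    rw [Set.sdiff_eq, Set.inter_comm]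
    exact nhdsWithin_inter_of_mem' (mem_nhdsWithin_of_mem_nhds hmem)
  have hdiff (i j : Fin 3) : DifferentiableAt ℝ (fun t => Afam t i j) 0 :=
    ((hanalytic i j).differentiableOn 0 (mem_of_mem_nhds hmem)).differentiableAt hmem
  have htend (i j : Fin 3) :
      Filter.Tendsto (fun t => Afam t i j) (nhdsWithin 0 {0}ᶜ) (nhds (Afam 0 i j)) :=
    (hdiff i j).continuousAt.tendsto.mono_left nhdsWithin_le_nhds
  have hentry : ∀ᶠ t in nhdsWithin (0 : ℝ) {0}ᶜ,
      t ≠ 0 ∧ t * Afam t 0 0 ^ 2 + t * Afam t 1 0 ^ 2 + Afam t 2 0 ^ 2 = t := by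
    filter_upwards [self_mem_nhdsWithin, mem_nhdsWithin_of_mem_nhds hmem] with t ht htI
    have h := congrFun (congrFun (hpres t htI ht) 0) 0
    simp [Q, Matrix.mul_apply, Fin.sum_univ_three, Matrix.diagonal_apply] at h
    exact ⟨ht, by linear_combination h⟩
  have hid : Filter.Tendsto (fun t : ℝ => t) (nhdsWithin 0 {0}ᶜ) (nhds 0) :=
    Filter.tendsto_id.mono_left nhdsWithin_le_nhds
  have hzero : Afam 0 2 0 = 0 := by
    have hlim := ((hid.mul ((htend 0 0).pow 2)).add
      (hid.mul ((htend 1 0).pow 2))).add ((htend 2 0).pow 2)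
    have hsq := tendsto_nhds_unique (hlim.congr' (hentry.mono fun t ht => ht.2)) hid
    simpa using hsq
  have hquot : Filter.Tendsto (fun t => (Afam t 2 0) ^ 2 / t)
      (nhdsWithin 0 {0}ᶜ) (nhds 0) := by
    have hslope := (hasDerivAt_iff_tendsto_slope.mp (hdiff 2 0).hasDerivAt).mul (htend 2 0)
    rw [hzero, mul_zero] at hslope
    refine hslope.congr fun t => ?_
    rw [slope_def_field, hzero]
    ring
  refine ⟨hzero, hfilter ▸ hquot, ?_⟩
  have hlim := (((htend 0 0).pow 2).add ((htend 1 0).pow 2)).add hquot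
  have hone := tendsto_nhds_unique (hlim.congr' (hentry.mono fun t ht => ?_))
    (tendsto_const_nhds (x := (1 : ℝ)))
  · simpa using hone
  · have ht0 := ht.1
    field_simp
    linear_combination ht.2
end

section
/- Every orientation-preserving Euclidean motion is coherent: for every rotation matrix R ∈ SO(2) and every vector v ∈ ℝ², there exists a family 𝒜 : [-1,1] → M₃(ℝ) whose nine entry functions are real-analytic on [-1,1], such that 𝒜(0) is the block matrix with upper-left 2×2 block R, upper-right column v, and third row (0,0,1), and such that for every t ∈ [-1,1] the matrix 𝒜(t) satisfies 𝒜(t)ᵀ Qₜ 𝒜(t) = Qₜ and det 𝒜(t) > 0. -/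
open Matrix

/-- A matrix is coherent if it is the value at `0` of an analytic family, over `[-1,1]`, of
isometries of the forms `qₜ` with positive determinant. -/
def IsCoherent (M : Matrix (Fin 3) (Fin 3) ℝ) : Prop :=
  ∃ A : ℝ → Matrix (Fin 3) (Fin 3) ℝ,
    (∀ i j : Fin 3, AnalyticOn ℝ (fun t => A t i j) (Set.Icc (-1 : ℝ) 1)) ∧
    A 0 = M ∧
    (∀ t ∈ Set.Icc (-1 : ℝ) 1, (A t)ᵀ * Q t * A t = Q t ∧ 0 < (A t).det)

theorem IsCoherent.mul {M N : Matrix (Fin 3) (Fin 3) ℝ} (hM : IsCoherent M)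
    (hN : IsCoherent N) : IsCoherent (M * N) := by
  obtain ⟨A, hA, rfl, hAQ⟩ := hM
  obtain ⟨B, hB, rfl, hBQ⟩ := hN
  refine ⟨fun t => A t * B t, fun i j => ?_, rfl, fun t ht => ⟨?_, ?_⟩⟩
  · simp only [Matrix.mul_apply, Fin.sum_univ_three]
    exact (((hA i 0).mul (hB 0 j)).add ((hA i 1).mul (hB 1 j))).add ((hA i 2).mul (hB 2 j))
  · calc (A t * B t)ᵀ * Q t * (A t * B t) = (B t)ᵀ * ((A t)ᵀ * Q t * A t) * B t := by
          simp only [Matrix.transpose_mul, Matrix.mul_assoc]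
      _ = Q t := by rw [(hAQ t ht).1, (hBQ t ht).1]
  · rw [Matrix.det_mul]
    exact mul_pos (hAQ t ht).2 (hBQ t ht).2

/-- The matrix of the translation of the plane by `(p, q)`. -/
def translationMatrix (p q : ℝ) : Matrix (Fin 3) (Fin 3) ℝ :=
  Matrix.of ![![1, 0, p], ![0, 1, q], ![0, 0, 1]]

theorem translationMatrix_mul (p q r s : ℝ) :
    translationMatrix p q * translationMatrix r s = translationMatrix (p + r) (q + s) := by
  ext i j
  fin_cases i <;> fin_cases j <;>
    simp [translationMatrix, Matrix.mul_apply, Fin.sum_univ_three, add_comm]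

/-- The Cayley transform of half the infinitesimal `qₜ`-isometry with upper-right column
`(p, q)`. -/
noncomputable def cayleyTranslation (p q t : ℝ) : Matrix (Fin 3) (Fin 3) ℝ :=
  let d := (1 + t * (p ^ 2 + q ^ 2) / 4)⁻¹
  Matrix.of ![![1 - t * p ^ 2 / 2 * d, -(t * p * q) / 2 * d, p * d],
    ![-(t * p * q) / 2 * d, 1 - t * q ^ 2 / 2 * d, q * d],
    ![-(t * p) * d, -(t * q) * d, 1 - t * (p ^ 2 + q ^ 2) / 2 * d]]

theorem transpose_mul_Q_mul_cayleyTranslation {p q t : ℝ}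
    (h : 1 + t * (p ^ 2 + q ^ 2) / 4 ≠ 0) :
    (cayleyTranslation p q t)ᵀ * Q t * cayleyTranslation p q t = Q t := by
  have hd := mul_inv_cancel₀ h
  unfold cayleyTranslation Q
  generalize (1 + t * (p ^ 2 + q ^ 2) / 4)⁻¹ = d at hd ⊢
  ext i j
  fin_cases i <;> fin_cases j <;>
    simp [Matrix.mul_apply, Fin.sum_univ_three, Matrix.diagonal] <;> grind

theorem det_cayleyTranslation {p q t : ℝ} (h : 1 + t * (p ^ 2 + q ^ 2) / 4 ≠ 0) :
    (cayleyTranslation p q t).det = 1 := by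
  have hd := mul_inv_cancel₀ h
  unfold cayleyTranslation
  generalize (1 + t * (p ^ 2 + q ^ 2) / 4)⁻¹ = d at hd ⊢
  simp [Matrix.det_fin_three]
  grind

theorem isCoherent_translationMatrix_of_lt {p q : ℝ} (h : p ^ 2 + q ^ 2 < 4) :
    IsCoherent (translationMatrix p q) := by
  have hne : ∀ t ∈ Set.Icc (-1 : ℝ) 1, 1 + t * (p ^ 2 + q ^ 2) / 4 ≠ 0 := by
    rintro t ⟨ht, -⟩
    nlinarith [sq_nonneg p, sq_nonneg q]
  have hd : AnalyticOn ℝ (fun t : ℝ => (1 + t * (p ^ 2 + q ^ 2) / 4)⁻¹) (Set.Icc (-1) 1) :=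
    AnalyticOn.inv (AnalyticOnNhd.analyticOn fun t _ => by fun_prop) hne
  refine ⟨cayleyTranslation p q, fun i j => ?_, ?_, fun t ht =>
    ⟨transpose_mul_Q_mul_cayleyTranslation (hne t ht), ?_⟩⟩
  · have hlin (a b c : ℝ) : AnalyticOn ℝ
        (fun t : ℝ => a + (b + t * c) * (1 + t * (p ^ 2 + q ^ 2) / 4)⁻¹) (Set.Icc (-1) 1) :=
      analyticOn_const.add ((AnalyticOnNhd.analyticOn fun t _ => by fun_prop).mul hd)
    fin_cases i <;> fin_cases j
    · exact (hlin 1 0 (-p ^ 2 / 2)).congr fun t _ => by simp [cayleyTranslation, -mul_eq_mul_right_iff]; ring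
    · exact (hlin 0 0 (-(p * q) / 2)).congr fun t _ => by simp [cayleyTranslation, -mul_eq_mul_right_iff]; ring
    · exact (hlin 0 p 0).congr fun t _ => by simp [cayleyTranslation]
    · exact (hlin 0 0 (-(p * q) / 2)).congr fun t _ => by simp [cayleyTranslation, -mul_eq_mul_right_iff]; ring
    · exact (hlin 1 0 (-q ^ 2 / 2)).congr fun t _ => by simp [cayleyTranslation, -mul_eq_mul_right_iff]; ring
    · exact (hlin 0 q 0).congr fun t _ => by simp [cayleyTranslation]
    · exact (hlin 0 0 (-p)).congr fun t _ => by simp [cayleyTranslation]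
    · exact (hlin 0 0 (-q)).congr fun t _ => by simp [cayleyTranslation]
    · exact (hlin 1 0 (-(p ^ 2 + q ^ 2) / 2)).congr fun t _ => by
        simp [cayleyTranslation, -mul_eq_mul_right_iff]; ring
  · simp [cayleyTranslation, translationMatrix]
  · rw [det_cayleyTranslation (hne t ht)]
    exact one_pos

theorem IsCoherent.translationMatrix_nsmul {p q : ℝ} (h : IsCoherent (translationMatrix p q))
    (n : ℕ) : IsCoherent (translationMatrix ((n + 1) * p) ((n + 1) * q)) := by
  induction n with
  | zero => simpa using h
  | succ n ih =>
    convert ih.mul h using 1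
    rw [translationMatrix_mul]
    push_cast
    ring_nf

theorem isCoherent_translationMatrix (p q : ℝ) : IsCoherent (translationMatrix p q) := by
  obtain ⟨n, hn⟩ := exists_nat_gt (p ^ 2 + q ^ 2)
  have hpos : (0 : ℝ) < n + 1 := by positivity
  have hsmall : (p / (n + 1)) ^ 2 + (q / (n + 1)) ^ 2 < 4 := by
    rw [div_pow, div_pow, ← add_div, div_lt_iff₀ (by positivity)]
    nlinarith
  have h := (isCoherent_translationMatrix_of_lt hsmall).translationMatrix_nsmul n
  rwa [mul_div_cancel₀ _ hpos.ne', mul_div_cancel₀ _ hpos.ne'] at h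

theorem isCoherent_rotation {R : Matrix (Fin 2) (Fin 2) ℝ} (hR : Rᵀ * R = 1)
    (hdetR : R.det = 1) :
    IsCoherent (Matrix.of ![![R 0 0, R 0 1, 0], ![R 1 0, R 1 1, 0], ![0, 0, 1]]) := by
  have h00 := congrFun₂ hR 0 0
  have h01 := congrFun₂ hR 0 1
  have h11 := congrFun₂ hR 1 1
  simp [Matrix.mul_apply] at h00 h01 h11
  rw [Matrix.det_fin_two] at hdetR
  refine ⟨fun _ => Matrix.of ![![R 0 0, R 0 1, 0], ![R 1 0, R 1 1, 0], ![0, 0, 1]],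
    fun i j => analyticOn_const, rfl, fun t _ => ⟨?_, ?_⟩⟩
  · ext i j
    fin_cases i <;> fin_cases j <;>
      simp [Q, Matrix.mul_apply, Fin.sum_univ_three, Matrix.diagonal] <;> grind
  · simp [Matrix.det_fin_three]
    linarith

/-- Every orientation-preserving Euclidean motion, given by a rotation matrix
`R ∈ SO(2)` and a translation vector `v ∈ ℝ²`, is coherent: it extends to a family
`𝒜 : [-1,1] → M₃(ℝ)` with real-analytic entries such that `𝒜(t)` preserves `qₜ` and
has positive determinant for all `t ∈ [-1,1]`. -/
theorem euclidean_motion_is_coherent (R : Matrix (Fin 2) (Fin 2) ℝ) (v : Fin 2 → ℝ)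
    (hR : Rᵀ * R = 1) (hdetR : R.det = 1) :
    ∃ Afam : ℝ → Matrix (Fin 3) (Fin 3) ℝ,
      (∀ i j : Fin 3, AnalyticOn ℝ (fun t => Afam t i j) (Set.Icc (-1 : ℝ) 1)) ∧
      Afam 0 = Matrix.of ![![R 0 0, R 0 1, v 0], ![R 1 0, R 1 1, v 1], ![0, 0, 1]] ∧
      (∀ t ∈ Set.Icc (-1 : ℝ) 1, (Afam t)ᵀ * Q t * Afam t = Q t ∧ 0 < (Afam t).det) := by
  have h := (isCoherent_translationMatrix (v 0) (v 1)).mul (isCoherent_rotation hR hdetR)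
  rw [show translationMatrix (v 0) (v 1) *
      Matrix.of ![![R 0 0, R 0 1, 0], ![R 1 0, R 1 1, 0], ![0, 0, 1]] =
      Matrix.of ![![R 0 0, R 0 1, v 0], ![R 1 0, R 1 1, v 1], ![0, 0, 1]] by
    ext i j
    fin_cases i <;> fin_cases j <;>
      simp [translationMatrix, Matrix.mul_apply, Fin.sum_univ_three]] at h
  exact h
end

section
/- For every x ∈ ℝ, the limit as t → 0 with t > 0 of (1/√t)·arccos(1/√(t·x² + 1)) equals |x|. That is, the normalized distance in the spherical geometry Eₜ between the coherent points represented by (0,0,1) and (x,0,1) converges to the Euclidean distance |x| as t → 0⁺. -/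
open Filter Topology

/-- The angular distance as an arctangent of `√t * |x|`. -/
theorem arccos_one_div_sqrt_eq_arctan {t : ℝ} (ht : 0 ≤ t) (x : ℝ) :
    Real.arccos (1 / Real.sqrt (t * x ^ 2 + 1)) = Real.arctan (Real.sqrt t * |x|) := by
  rw [Real.arctan_eq_arccos (by positivity), mul_pow, Real.sq_sqrt ht, sq_abs, one_div, add_comm]

theorem tendsto_sqrt_nhdsGT_zero : Tendsto Real.sqrt (𝓝[>] 0) (𝓝[>] 0) := by
  refine tendsto_nhdsWithin_iff.2 ⟨?_, ?_⟩
  · simpa using (Real.continuous_sqrt.tendsto 0).mono_left nhdsWithin_le_nhds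
  · filter_upwards [self_mem_nhdsWithin] with t ht using Real.sqrt_pos.2 ht

theorem tendsto_inv_mul_arctan_mul (c : ℝ) :
    Tendsto (fun s : ℝ => s⁻¹ * Real.arctan (s * c)) (𝓝[>] 0) (𝓝 c) := by
  have h : HasDerivAt (fun s : ℝ => Real.arctan (s * c)) c 0 := by
    simpa using ((hasDerivAt_id (0 : ℝ)).mul_const c).arctan
  simpa using h.tendsto_slope_zero_right

/-- The normalized spherical distance between the coherent points represented by
`(0,0,1)` and `(x,0,1)` converges to the Euclidean distance `|x|` as `t → 0⁺`:
`lim_{t→0⁺} (1/√t)·arccos(1/√(t·x² + 1)) = |x|`. -/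
theorem spherical_distance_tendsto_euclidean (x : ℝ) :
    Tendsto (fun t : ℝ => (1 / Real.sqrt t) * Real.arccos (1 / Real.sqrt (t * x ^ 2 + 1)))
      (𝓝[>] 0) (𝓝 |x|) := by
  refine ((tendsto_inv_mul_arctan_mul |x|).comp tendsto_sqrt_nhdsGT_zero).congr' ?_
  filter_upwards [self_mem_nhdsWithin] with t ht
  rw [arccos_one_div_sqrt_eq_arctan (le_of_lt ht), one_div, Function.comp_apply]
end

section
/- For every x ∈ ℝ, the limit as t → 0 with t < 0 of (1/√(−t))·arcosh(1/√(1 + t·x²)) equals |x|, where the expression is considered for those t < 0 with 1 + t·x² > 0. That is, the normalized distance in the hyperbolic geometry Eₜ between the points represented by (0,0,1) and (x,0,1) converges to the Euclidean distance |x| as t → 0⁻. -/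
open Filter Topology

/-- The inverse hyperbolic cosine on `[1, ∞)`: `arcosh x = log (x + √(x² − 1))`. -/
noncomputable def arcosh (x : ℝ) : ℝ := Real.log (x + Real.sqrt (x ^ 2 - 1))

theorem arcosh_one_div_sqrt_one_sub_sq {u : ℝ} (h0 : 0 ≤ u) (h1 : 0 < 1 - u ^ 2) :
    arcosh (1 / Real.sqrt (1 - u ^ 2)) = Real.log (1 + u) - Real.log (1 - u ^ 2) / 2 := by
  have hs : 0 < Real.sqrt (1 - u ^ 2) := Real.sqrt_pos.2 h1
  have h2 : (1 / Real.sqrt (1 - u ^ 2)) ^ 2 - 1 = (u / Real.sqrt (1 - u ^ 2)) ^ 2 := by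
    rw [div_pow, div_pow, Real.sq_sqrt h1.le]
    field_simp
    ring
  rw [arcosh, h2, Real.sqrt_sq (by positivity), ← add_div,
    Real.log_div (by positivity) hs.ne', Real.log_sqrt h1.le]

theorem hasDerivAt_log_one_add_sub_log_one_sub_sq (a : ℝ) :
    HasDerivAt (fun s : ℝ => Real.log (1 + s * a) - Real.log (1 - (s * a) ^ 2) / 2) a 0 := by
  have h : HasDerivAt (fun s : ℝ => s * a) a 0 := by
    simpa using (hasDerivAt_id (0 : ℝ)).mul_const a
  have h1 := (h.const_add 1).log (by simp)
  have h2 := (((h.pow 2).const_sub 1).log (by simp)).div_const 2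
  exact (h1.sub h2).congr_deriv (by simp)

/-- The normalized hyperbolic distance between the points represented by `(0,0,1)` and
`(x,0,1)` converges to the Euclidean distance `|x|` as `t → 0⁻`, the expression being
considered for those `t < 0` with `1 + t·x² > 0`:
`lim_{t→0⁻} (1/√(−t))·arcosh(1/√(1 + t·x²)) = |x|`. -/
theorem hyperbolic_distance_tendsto_euclidean (x : ℝ) :
    Tendsto (fun t : ℝ => (1 / Real.sqrt (-t)) * arcosh (1 / Real.sqrt (1 + t * x ^ 2)))
      (𝓝[{t : ℝ | t < 0 ∧ 0 < 1 + t * x ^ 2}] 0) (𝓝 |x|) := by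
  have hslope := hasDerivAt_iff_tendsto_slope_zero.1
    (hasDerivAt_log_one_add_sub_log_one_sub_sq |x|)
  have hsqrt : Tendsto (fun t : ℝ => Real.sqrt (-t))
      (𝓝[{t : ℝ | t < 0 ∧ 0 < 1 + t * x ^ 2}] 0) (𝓝[≠] 0) := by
    refine tendsto_nhdsWithin_iff.2 ⟨?_, ?_⟩
    · have hc : Continuous fun t : ℝ => Real.sqrt (-t) := by fun_prop
      exact (hc.tendsto' 0 0 (by simp)).mono_left nhdsWithin_le_nhds
    · filter_upwards [self_mem_nhdsWithin] with t ht
      exact (Real.sqrt_pos.2 (neg_pos.2 ht.1)).ne'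
  refine (hslope.comp hsqrt).congr' ?_
  filter_upwards [self_mem_nhdsWithin] with t ht
  have hu : 1 + t * x ^ 2 = 1 - (Real.sqrt (-t) * |x|) ^ 2 := by
    rw [mul_pow, Real.sq_sqrt (neg_pos.2 ht.1).le, sq_abs]
    ring
  have hpos := ht.2
  rw [hu] at hpos ⊢
  rw [arcosh_one_div_sqrt_one_sub_sq (by positivity) hpos]
  simp
end

section
/- For all x, y ∈ ℝ, the limit as t → 0 with t > 0 of (1/√t)·arccos(1/(√(t·x² + 1)·√(t·y² + 1))) equals √(x² + y²). That is, the normalized distance in Eₜ between the coherent points represented by (x,0,1) and (0,y,1) converges to the Euclidean distance √(x²+y²) as t → 0⁺. -/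
open Filter Topology

theorem Real.mul_dslope_arctan_zero (u : ℝ) : u * dslope Real.arctan 0 u = Real.arctan u := by
  simpa using sub_smul_dslope Real.arctan 0 u

theorem Real.arccos_inv_sqrt_mul_sqrt {a b : ℝ} (ha : 0 ≤ a) (hb : 0 ≤ b) :
    Real.arccos (1 / (√(a + 1) * √(b + 1))) = Real.arctan √(a + b + a * b) := by
  rw [Real.arctan_eq_arccos (Real.sqrt_nonneg _), Real.sq_sqrt (by positivity),
    ← Real.sqrt_mul (by positivity), one_div]
  ring_nf

/-- The normalized spherical distance between the coherent points represented by
`(x,0,1)` and `(0,y,1)` converges to the Euclidean distance `√(x² + y²)` as `t → 0⁺`: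
`lim_{t→0⁺} (1/√t)·arccos(1/(√(t·x² + 1)·√(t·y² + 1))) = √(x² + y²)`. -/
theorem spherical_distance_hypotenuse_tendsto (x y : ℝ) :
    Tendsto (fun t : ℝ => (1 / Real.sqrt t) *
        Real.arccos (1 / (Real.sqrt (t * x ^ 2 + 1) * Real.sqrt (t * y ^ 2 + 1))))
      (𝓝[>] 0) (𝓝 (Real.sqrt (x ^ 2 + y ^ 2))) := by
  set g : ℝ → ℝ := fun t => √(x ^ 2 + y ^ 2 + t * (x ^ 2 * y ^ 2)) with hg
  have hgc : Continuous g := by fun_prop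
  have hd : ContinuousAt (dslope Real.arctan 0) 0 :=
    continuousAt_dslope_same.2 (Real.hasDerivAt_arctan 0).differentiableAt
  have hu : Tendsto (fun t => √t * g t) (𝓝 0) (𝓝 0) := by
    simpa using (Real.continuous_sqrt.tendsto 0).mul (hgc.tendsto 0)
  have hlim : Tendsto (fun t => g t * dslope Real.arctan 0 (√t * g t)) (𝓝 0)
      (𝓝 √(x ^ 2 + y ^ 2)) := by
    simpa [hg, (Real.hasDerivAt_arctan 0).deriv] using (hgc.tendsto 0).mul (hd.tendsto.comp hu)
  refine (hlim.mono_left nhdsWithin_le_nhds).congr' ?_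
  filter_upwards [self_mem_nhdsWithin] with t (ht : 0 < t)
  have hsqrt : √(t * x ^ 2 + t * y ^ 2 + t * x ^ 2 * (t * y ^ 2)) = √t * g t := by
    rw [hg, ← Real.sqrt_mul ht.le]
    ring_nf
  rw [Real.arccos_inv_sqrt_mul_sqrt (by positivity) (by positivity), hsqrt,
    ← Real.mul_dslope_arctan_zero]
  have : √t ≠ 0 := (Real.sqrt_pos.2 ht).ne'
  field_simp
end

section
/- For fixed a, b > 0, define F(s) = (1 + cos(s·a) + cos(s·b) + cos(s·a)·cos(s·b))² / (2·(1 + cos(s·a))·(1 + cos(s·b))·(1 + cos(s·a)·cos(s·b))) for s near 0. Then the limit as s → 0 of (1 − F(s) − (1/16)·a²·b²·s⁴)/s⁶ equals (a²·b⁴ + a⁴·b²)/96; that is, 1 − F(s) = (1/16)a²b²s⁴ + (1/96)(a²b⁴ + a⁴b²)s⁶ + O(s⁸). -/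
open Filter Topology

/-- The fourth-order Taylor coefficient of the cosine at `0`, as a limit. -/
theorem tendsto_cos_sub_quadratic_div_pow_four :
    Tendsto (fun x : ℝ => (Real.cos x - 1 + x ^ 2 / 2) / x ^ 4) (𝓝[≠] 0) (𝓝 (1 / 24)) := by
  have h := (taylor_isLittleO_univ (x₀ := 0) (n := 4) Real.contDiff_cos).tendsto_div_nhds_zero
  have h' := (h.mono_left (nhdsWithin_le_nhds (s := {0}ᶜ))).add_const (1 / 24 : ℝ)
  rw [zero_add] at h'
  refine h'.congr' ?_
  filter_upwards [self_mem_nhdsWithin] with x (hx : x ≠ 0)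
  simp [taylor_within_apply, iteratedDerivWithin_univ, iteratedDeriv_succ, Nat.factorial]
  field_simp
  ring

/-- If `cos (s c) = 1 - s² c² / 2 + s⁴ c⁴ q`, then `q → 1 / 24` as `s → 0`. -/
theorem exists_cos_mul_eq_quartic (c : ℝ) (hc : c ≠ 0) :
    ∃ q : ℝ → ℝ, Tendsto q (𝓝[≠] 0) (𝓝 (1 / 24)) ∧
      ∀ s ≠ 0, Real.cos (s * c) = 1 - s ^ 2 * c ^ 2 / 2 + s ^ 4 * c ^ 4 * q s := by
  have hmul : Tendsto (fun s : ℝ => s * c) (𝓝[≠] 0) (𝓝[≠] 0) := by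
    refine tendsto_nhdsWithin_iff.2 ⟨?_, ?_⟩
    · exact ((continuous_mul_const c).tendsto' 0 0 (zero_mul c)).mono_left nhdsWithin_le_nhds
    · filter_upwards [self_mem_nhdsWithin] with s hs using mul_ne_zero hs hc
  refine ⟨_, tendsto_cos_sub_quadratic_div_pow_four.comp hmul, fun s hs => ?_⟩
  simp only [Function.comp_apply]
  field_simp
  ring

/-- The area quotient in terms of the quartic remainders `p`, `q` of the two cosines. -/
theorem one_sub_area_quotient_eq {a b s x y p q : ℝ} (hs : s ≠ 0)
    (hx : x = 1 - s ^ 2 * a ^ 2 / 2 + s ^ 4 * a ^ 4 * p)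
    (hy : y = 1 - s ^ 2 * b ^ 2 / 2 + s ^ 4 * b ^ 4 * q)
    (hx0 : 1 + x ≠ 0) (hy0 : 1 + y ≠ 0) (hxy0 : 1 + x * y ≠ 0) :
    (1 - (1 + x + y + x * y) ^ 2 / (2 * (1 + x) * (1 + y) * (1 + x * y)) -
        (1 / 16) * a ^ 2 * b ^ 2 * s ^ 4) / s ^ 6 =
      a ^ 2 * b ^ 2 * (-4 * (a ^ 2 * p + b ^ 2 * q) + 8 * a ^ 2 * b ^ 2 * s ^ 2 * p * q +
        a ^ 2 * (1 / 2 - a ^ 2 * s ^ 2 * p) + b ^ 2 * (1 / 2 - b ^ 2 * s ^ 2 * q) -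
        a ^ 2 * b ^ 2 * s ^ 2 * (1 / 2 - a ^ 2 * s ^ 2 * p) * (1 / 2 - b ^ 2 * s ^ 2 * q)) /
        (16 * (1 + x * y)) := by
  have hF : 1 - (1 + x + y + x * y) ^ 2 / (2 * (1 + x) * (1 + y) * (1 + x * y)) =
      (1 - x) * (1 - y) / (2 * (1 + x * y)) := by
    field_simp
    ring
  rw [hF]
  field_simp
  rw [hx, hy]
  ring


/-- For fixed `a, b > 0`, let
`F(s) = (1 + cos(sa) + cos(sb) + cos(sa)·cos(sb))² /
        (2·(1 + cos(sa))·(1 + cos(sb))·(1 + cos(sa)·cos(sb)))`.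
Then `lim_{s→0} (1 − F(s) − (1/16)a²b²s⁴)/s⁶ = (a²b⁴ + a⁴b²)/96`, i.e.
`1 − F(s) = (1/16)a²b²s⁴ + (1/96)(a²b⁴ + a⁴b²)s⁶ + O(s⁸)`. -/
theorem area_second_order_term (a b : ℝ) (ha : 0 < a) (hb : 0 < b) :
    Tendsto (fun s : ℝ =>
        (1 - (1 + Real.cos (s * a) + Real.cos (s * b) + Real.cos (s * a) * Real.cos (s * b)) ^ 2 /
            (2 * (1 + Real.cos (s * a)) * (1 + Real.cos (s * b)) *
              (1 + Real.cos (s * a) * Real.cos (s * b))) -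
          (1 / 16) * a ^ 2 * b ^ 2 * s ^ 4) / s ^ 6)
      (𝓝[≠] 0) (𝓝 ((a ^ 2 * b ^ 4 + a ^ 4 * b ^ 2) / 96)) := by
  obtain ⟨p, hp, hx⟩ := exists_cos_mul_eq_quartic a ha.ne'
  obtain ⟨q, hq, hy⟩ := exists_cos_mul_eq_quartic b hb.ne'
  have hid : Tendsto (fun s : ℝ => s) (𝓝[≠] 0) (𝓝 0) := nhdsWithin_le_nhds
  have hcos (c : ℝ) : Tendsto (fun s : ℝ => Real.cos (s * c)) (𝓝[≠] 0) (𝓝 1) :=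
    ((by fun_prop : Continuous fun s : ℝ => Real.cos (s * c)).tendsto' 0 1
      (by simp)).mono_left nhdsWithin_le_nhds
  have hcos_ne (c : ℝ) : ∀ᶠ s in 𝓝[≠] (0 : ℝ), 1 + Real.cos (s * c) ≠ 0 :=
    ((hcos c).const_add 1).eventually_ne (by norm_num)
  have hden : Tendsto (fun s : ℝ => 1 + Real.cos (s * a) * Real.cos (s * b)) (𝓝[≠] 0)
      (𝓝 (1 + 1 * 1)) := ((hcos a).mul (hcos b)).const_add 1
  have hs2 := hid.pow 2
  have hP := ((hs2.const_mul (a ^ 2)).mul hp).const_sub (1 / 2)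
  have hQ := ((hs2.const_mul (b ^ 2)).mul hq).const_sub (1 / 2)
  have hnum := ((((((hp.const_mul (a ^ 2)).add (hq.const_mul (b ^ 2))).const_mul (-4)).add
    (((hs2.const_mul (8 * a ^ 2 * b ^ 2)).mul hp).mul hq)).add (hP.const_mul (a ^ 2))).add
    (hQ.const_mul (b ^ 2))).sub (((hs2.const_mul (a ^ 2 * b ^ 2)).mul hP).mul hQ)
  have hlim := (hnum.const_mul (a ^ 2 * b ^ 2)).div (hden.const_mul 16) (by norm_num)
  convert hlim.congr' ?_ using 2
  · ring
  · filter_upwards [self_mem_nhdsWithin, hcos_ne a, hcos_ne b,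
      hden.eventually_ne (by norm_num : (1 + 1 * 1 : ℝ) ≠ 0)] with s hs hxs hys hxys
    exact (one_sub_area_quotient_eq hs (hx s hs) (hy s hs) hxs hys hxys).symm
end

section
/- Transition of area: for fixed a, b > 0, define F(s) = (1 + cos(s·a) + cos(s·b) + cos(s·a)·cos(s·b))² / (2·(1 + cos(s·a))·(1 + cos(s·b))·(1 + cos(s·a)·cos(s·b))) and, for s > 0 small enough that F(s) ∈ (0,1], let Δ(s) = 2·arccos(√(F(s))) be the area of the right spherical triangle with legs a and b in the geometry of curvature s⁴. Then the normalized area Δ(s)/s² converges, as s → 0⁺, to a·b/2, the Euclidean area of a right triangle with legs a and b. -/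
open Filter Topology

/-- The right spherical triangle with legs `u, v` has half area
`arctan (tan (u / 2) * tan (v / 2))`. -/
lemma arccos_sqrt_eq_arctan_tan_mul_tan {u v : ℝ} (hu : 0 ≤ u) (huπ : u < Real.pi)
    (hv : 0 ≤ v) (hvπ : v < Real.pi) :
    Real.arccos (Real.sqrt
      ((1 + Real.cos u + Real.cos v + Real.cos u * Real.cos v) ^ 2 /
        (2 * (1 + Real.cos u) * (1 + Real.cos v) * (1 + Real.cos u * Real.cos v)))) =
      Real.arctan (Real.tan (u / 2) * Real.tan (v / 2)) := by
  have hcu : 0 < Real.cos (u / 2) := Real.cos_pos_of_mem_Ioo ⟨by linarith, by linarith⟩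
  have hcv : 0 < Real.cos (v / 2) := Real.cos_pos_of_mem_Ioo ⟨by linarith, by linarith⟩
  have htu : 0 ≤ Real.tan (u / 2) :=
    Real.tan_nonneg_of_nonneg_of_le_pi_div_two (by linarith) (by linarith)
  have htv : 0 ≤ Real.tan (v / 2) :=
    Real.tan_nonneg_of_nonneg_of_le_pi_div_two (by linarith) (by linarith)
  rw [Real.arctan_eq_arccos (mul_nonneg htu htv), ← Real.sqrt_inv]
  congr 2
  have hu2 : Real.cos u = 2 * Real.cos (u / 2) ^ 2 - 1 := by
    rw [← Real.cos_two_mul, mul_div_cancel₀ u two_ne_zero]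
  have hv2 : Real.cos v = 2 * Real.cos (v / 2) ^ 2 - 1 := by
    rw [← Real.cos_two_mul, mul_div_cancel₀ v two_ne_zero]
  rw [hu2, hv2, Real.tan_eq_sin_div_cos, Real.tan_eq_sin_div_cos, mul_pow, div_pow, div_pow,
    Real.sin_sq, Real.sin_sq]
  have hp1 := Real.cos_sq_le_one (u / 2)
  have hq1 := Real.cos_sq_le_one (v / 2)
  have hp : 0 < Real.cos (u / 2) ^ 2 := pow_pos hcu 2
  have hq : 0 < Real.cos (v / 2) ^ 2 := pow_pos hcv 2
  generalize Real.cos (u / 2) ^ 2 = p at *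
  generalize Real.cos (v / 2) ^ 2 = q at *
  have hpq : 0 < p * q + (1 - p) * (1 - q) :=
    add_pos_of_pos_of_nonneg (mul_pos hp hq) (mul_nonneg (by linarith) (by linarith))
  have hrhs : (1 + (1 - p) / p * ((1 - q) / q))⁻¹ = p * q / (p * q + (1 - p) * (1 - q)) := by
    rw [div_mul_div_comm, one_add_div (mul_pos hp hq).ne', inv_div]
  have hden : 2 * (1 + (2 * p - 1)) * (1 + (2 * q - 1)) * (1 + (2 * p - 1) * (2 * q - 1)) =
      16 * (p * q) * (p * q + (1 - p) * (1 - q)) := by ring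
  rw [hrhs, hden, div_eq_div_iff (by positivity) hpq.ne']
  ring

lemma tendsto_tan_mul_div_two_div (a : ℝ) :
    Tendsto (fun s : ℝ => Real.tan (s * a / 2) / s) (𝓝[>] 0) (𝓝 (a / 2)) := by
  have h : HasDerivAt (fun s : ℝ => Real.tan (s * a / 2)) (a / 2) 0 := by
    have htan : HasDerivAt Real.tan 1 ((0 : ℝ) * a / 2) := by
      simpa using Real.hasDerivAt_tan (x := 0) (by simp)
    simpa [Function.comp_def] using htan.comp 0 (((hasDerivAt_id (0 : ℝ)).mul_const a).div_const 2)
  refine (h.tendsto_slope.mono_left (nhdsGT_le_nhdsNE 0)).congr fun s => ?_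
  simp [slope_def_field]

/-- Transition of area: for fixed `a, b > 0`, with
`F(s) = (1 + cos(sa) + cos(sb) + cos(sa)·cos(sb))² /
        (2·(1 + cos(sa))·(1 + cos(sb))·(1 + cos(sa)·cos(sb)))`
and `Δ(s) = 2·arccos(√(F(s)))` the area of the right spherical triangle with legs
`a, b` in the geometry of curvature `s⁴`, the normalized area `Δ(s)/s²` converges
as `s → 0⁺` to `a·b/2`, the Euclidean area of a right triangle with legs `a` and `b`. -/
theorem area_transition (a b : ℝ) (ha : 0 < a) (hb : 0 < b) :
    Tendsto (fun s : ℝ =>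
        2 * Real.arccos (Real.sqrt
          ((1 + Real.cos (s * a) + Real.cos (s * b) + Real.cos (s * a) * Real.cos (s * b)) ^ 2 /
            (2 * (1 + Real.cos (s * a)) * (1 + Real.cos (s * b)) *
              (1 + Real.cos (s * a) * Real.cos (s * b))))) / s ^ 2)
      (𝓝[>] 0) (𝓝 (a * b / 2)) := by
  have hA := tendsto_tan_mul_div_two_div a
  have hB := tendsto_tan_mul_div_two_div b
  have hid : Tendsto (fun s : ℝ => s) (𝓝[>] 0) (𝓝 0) :=
    tendsto_nhdsWithin_of_tendsto_nhds tendsto_id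
  have hT : Tendsto (fun s : ℝ => Real.tan (s * a / 2) * Real.tan (s * b / 2)) (𝓝[>] 0)
      (𝓝 0) := by
    have h := (hA.mul hB).mul (hid.pow 2)
    rw [zero_pow two_ne_zero, mul_zero] at h
    refine h.congr' ?_
    filter_upwards [self_mem_nhdsWithin] with s hs
    have hs0 : s ≠ 0 := ne_of_gt hs
    field_simp
  have hD : Tendsto (fun s : ℝ => dslope Real.arctan 0
      (Real.tan (s * a / 2) * Real.tan (s * b / 2))) (𝓝[>] 0) (𝓝 1) := by
    have hc := (continuousAt_dslope_same.2 (Real.hasDerivAt_arctan 0).differentiableAt).tendsto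
    rw [dslope_same, (Real.hasDerivAt_arctan 0).deriv] at hc
    simpa [Function.comp_def] using hc.comp hT
  have hlt (c : ℝ) : ∀ᶠ s : ℝ in 𝓝[>] 0, s * c < Real.pi := by
    have h := hid.mul_const c
    rw [zero_mul] at h
    exact h.eventually_lt_const Real.pi_pos
  have hmain := ((hD.mul hA).mul hB).const_mul 2
  rw [show 2 * (1 * (a / 2) * (b / 2)) = a * b / 2 by ring] at hmain
  refine hmain.congr' ?_
  filter_upwards [self_mem_nhdsWithin, hlt a, hlt b] with s hs hsa hsb
  have hs0 : 0 < s := hs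
  rw [arccos_sqrt_eq_arctan_tan_mul_tan (by positivity) hsa (by positivity) hsb]
  have h := sub_smul_dslope Real.arctan 0 (Real.tan (s * a / 2) * Real.tan (s * b / 2))
  rw [sub_zero, Real.arctan_zero, sub_zero, smul_eq_mul] at h
  rw [← h]
  field_simp
end
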